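/- The algebra (KP, ⋆) is freely generated by the set {Q_a : a an atomic parking function}; that is, the canonical algebra map from the free associative K-algebra on the set of atomic parking functions, sending the generator a to Q_a, is an isomorphism onto (KP, ⋆). -/

import Mathlib

open scoped Classical

/-- Words on natural numbers (letters are intended to be positive integers). -/
abbrev W : Type := List ℕ

/-- `IsPF a` : the word `a` is a parking function, i.e. all its letters are
positive and its nondecreasing rearrangement `b₁ b₂ ⋯ bₙ` satisfies `bᵢ ≤ i`. -/
def IsPF (a : W) : Prop :=
  (∀ x ∈ a, 1 ≤ x) ∧
    ∀ i, i < a.length → (a.insertionSort (· ≤ ·)).getD i 0 ≤ i + 1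

/-- Split a word into the consecutive segments beginning at its
left-to-right minima (in the order in which they occur in the word). -/
def segs : W → List W
  | [] => []
  | x :: xs =>
      (x :: xs.takeWhile fun y => x ≤ y) :: segs (xs.dropWhile fun y => x ≤ y)
termination_by a => a.length
decreasing_by
  simpa using Nat.lt_succ_of_le (List.dropWhile_sublist _).length_le

/-- The LR-decomposition `F_a` of a word `a`: the sequence of segments beginning
at the left-to-right minima, listed in increasing order of their minimal letters
(i.e. in reverse order of occurrence in `a`). -/
def LR (a : W) : List W := (segs a).reverse

/-- The word `w_k ⋯ w_2 w_1` encoded by an LR-decomposition `(w_1, …, w_k)`. -/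
def wordOf (F : List W) : W := F.reverse.flatten

/-- A word is dominated if it is nonempty and its first letter is its minimal letter. -/
def Dominated (w : W) : Prop := w ≠ [] ∧ ∀ x ∈ w, w.headD 0 ≤ x

/-- The minimal letter of a word (`0` for the empty word). -/
def minW (w : W) : ℕ := (w.min?).getD 0

/-- Add `m` to every letter of a word. -/
def shiftW (m : ℕ) (w : W) : W := w.map (· + m)

/-- Add `m` to every letter of every word of a sequence of words. -/
def shiftF (m : ℕ) (F : List W) : List W := F.map (shiftW m)

/-- The word whose LR-decomposition is the finite set of words `G`:
sort `G` increasingly (for dominated words with distinct minimal letters the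
lexicographic order agrees with comparing the minimal letters) and concatenate
in decreasing order. -/
noncomputable def wordOfSet (G : Finset W) : W := (G.sort (· ≤ ·)).reverse.flatten

/-- Given vertex sets `X`, `Y` (of words) and a set `Θ` of edges, the resulting
set of words: concatenations `u ++ w` over edges `(u, w) ∈ Θ`, together with all
unmatched words of `X` and of `Y`. -/
noncomputable def glueSet (X Y : Finset W) (Θ : Finset (W × W)) : Finset W :=
  Θ.image (fun p => p.1 ++ p.2) ∪
    X.filter (fun u => ∀ p ∈ Θ, p.1 ≠ u) ∪
    Y.filter (fun w => ∀ p ∈ Θ, p.2 ≠ w)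

/-- `R(a,b)` : the set of matchings between `F_a` and `F_b + m` (`m` the length
of `a`), encoded as sets of edges in which no vertex occurs twice. -/
noncomputable def Rset (a b : W) : Finset (Finset (W × W)) :=
  ((LR a).toFinset ×ˢ (shiftF a.length (LR b)).toFinset).powerset.filter
    (fun Θ => ∀ p ∈ Θ, ∀ q ∈ Θ, (p.1 = q.1 ∨ p.2 = q.2) → p = q)

/-- `aΘb` : the parking function whose LR-decomposition consists of the
concatenations `u ⬝ (w + m)` over the edges `(u, w + m)` of `Θ` together with all
unmatched words of `F_a` and of `F_b + m`. -/
noncomputable def mTheta (a b : W) (Θ : Finset (W × W)) : W :=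
  wordOfSet (glueSet (LR a).toFinset (shiftF a.length (LR b)).toFinset Θ)

/-- `d(a) = min { i : #{ j : a_j ≤ i } < i }`. -/
def dVal (a : W) : ℕ :=
  Nat.find (p := fun i => (a.filter (fun x => x ≤ i)).length < i)
    ⟨a.length + 1, Nat.lt_succ_of_le (List.length_filter_le _ _)⟩

/-- One step of the parkization algorithm: decrement every letter greater
than `d(a)`.  (This is the identity when `a` is a parking function.) -/
def parkStep (a : W) : W := a.map fun x => if dVal a < x then x - 1 else x

/-- Auxiliary fueled version of the parkization algorithm. -/
def parkFuel : ℕ → W → W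
  | 0, a => a
  | k + 1, a => if dVal a = a.length + 1 then a else parkFuel k (parkStep a)

/-- The parkization `Park a` of a word `a`.  (For a word with positive letters
the algorithm needs at most `a.sum` steps, so the fuel below suffices.) -/
def Park (a : W) : W := parkFuel a.sum a

/-- The subword of `a` obtained by keeping exactly the words of `F_a`
belonging to `S`. -/
def subWord (a : W) (S : Finset W) : W := wordOf ((LR a).filter (· ∈ S))

/-- The free module with basis indexed by words; the Hopf algebra `PFSym` is
its submodule spanned by `{M_a : a ∈ P}`. -/
abbrev FW (K : Type) [Field K] : Type := W →₀ K

/-- The monomial basis element `M_a`. -/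
noncomputable def Mb (K : Type) [Field K] (a : W) : FW K := Finsupp.single a 1

/-- `M_a ⋆ M_b = Σ_{Θ ∈ R(a,b)} M_{aΘb}` on basis elements. -/
noncomputable def mulSingle (K : Type) [Field K] (a b : W) : FW K :=
  ∑ Θ ∈ Rset a b, Mb K (mTheta a b Θ)

/-- The product `⋆`, extended bilinearly. -/
noncomputable def starF (K : Type) [Field K] (x y : FW K) : FW K :=
  x.sum fun a ca => y.sum fun b cb => (ca * cb) • mulSingle K a b

/-- The free module with basis indexed by pairs of words; it realizes the
tensor square of `FW K` via `M_a ⊗ M_b ↦ single (a,b)`. -/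
abbrev FW2 (K : Type) [Field K] : Type := (W × W) →₀ K

/-- `Δ(M_a) = Σ M_{Park a'} ⊗ M_{Park a''}` over ordered pairs `(a', a'')` of
subwords of `a` with `F_{a'} ⊍ F_{a''} = F_a` (encoded by the subset
`S ⊆ F_a` of words kept in `a'`). -/
noncomputable def deltaSingle (K : Type) [Field K] (a : W) : FW2 K :=
  ∑ S ∈ ((LR a).toFinset).powerset,
    Finsupp.single
      (Park (subWord a S), Park (subWord a (((LR a).toFinset) \ S))) 1

/-- The coproduct `Δ`, extended linearly. -/
noncomputable def deltaF (K : Type) [Field K] (x : FW K) : FW2 K :=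
  x.sum fun a ca => ca • deltaSingle K a

/-- The componentwise product on the tensor square, on basis elements:
`(M_a ⊗ M_b) ⋆ (M_c ⊗ M_d) = (M_a ⋆ M_c) ⊗ (M_b ⋆ M_d)`. -/
noncomputable def star2Single (K : Type) [Field K] (p q : W × W) : FW2 K :=
  ∑ Θ ∈ Rset p.1 q.1, ∑ Θ' ∈ Rset p.2 q.2,
    Finsupp.single (mTheta p.1 q.1 Θ, mTheta p.2 q.2 Θ') 1

/-- The componentwise product on the tensor square, extended bilinearly. -/
noncomputable def star2F (K : Type) [Field K] (x y : FW2 K) : FW2 K :=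
  x.sum fun p cp => y.sum fun q cq => (cp * cq) • star2Single K p q

/-- The counit `ε` on basis elements. -/
noncomputable def epsW (K : Type) [Field K] (a : W) : K := if a = [] then 1 else 0

/-- `F_a ∘ F_b` : concatenate the `i`-th words of `F_a` and `F_b + m`
for `i ≤ min(r,s)` and keep the remaining unpaired words. -/
def splitLR (F G : List W) : List W :=
  List.zipWith (· ++ ·) F G ++ F.drop G.length ++ G.drop F.length

/-- The split product `a ∘ b`. -/
def splitProd (a b : W) : W := wordOf (splitLR (LR a) (shiftF a.length (LR b)))

/-- A nonempty parking function is unsplitable if it is not the split product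
of two nonempty parking functions. -/
def UnsplitablePF (a : W) : Prop :=
  IsPF a ∧ a ≠ [] ∧
    ¬ ∃ b c : W, IsPF b ∧ IsPF c ∧ b ≠ [] ∧ c ≠ [] ∧ a = splitProd b c

/-- The slash product `a | b = (b₁+m) ⋯ (bₙ+m) a₁ ⋯ a_m`. -/
def slashProd (a b : W) : W := shiftW a.length b ++ a

/-- A nonempty parking function is atomic if it is not the slash product
of two nonempty parking functions. -/
def AtomicPF (a : W) : Prop :=
  IsPF a ∧ a ≠ [] ∧
    ¬ ∃ b c : W, IsPF b ∧ IsPF c ∧ b ≠ [] ∧ c ≠ [] ∧ a = slashProd b c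

/-- `u ≺* v` : either `v` is a proper initial subword of `u`, or `u` is not a
proper initial subword of `v` and `u` precedes `v` lexicographically. -/
def precStar (u v : W) : Prop :=
  (v <+: u ∧ v ≠ u) ∨ (¬ (u <+: v ∧ u ≠ v) ∧ List.Lex (· < ·) u v)

/-- `a ≺*_lex b` : `F_a` strictly precedes `F_b` in the lexicographic order
on sequences of words induced by `≺*`. -/
def precStarLex (a b : W) : Prop := List.Lex precStar (LR a) (LR b)

/-- The covering relation of `≤_*` : `b` covers `a` if `F_b` is obtained from
`F_a = (w_1, …, w_r)` by replacing `w_i` by `w_i ⬝ w_j` and removing `w_j`,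
for some `i < j` such that every letter of `w_i` is at most every letter of `w_j`. -/
def CovStar (a b : W) : Prop :=
  ∃ i j, i < j ∧ j < (LR a).length ∧
    (∀ x ∈ (LR a).getD i [], ∀ y ∈ (LR a).getD j [], x ≤ y) ∧
    LR b = ((LR a).set i ((LR a).getD i [] ++ (LR a).getD j [])).eraseIdx j

/-- The partial order `≤_*` on parking functions, generated by the covering
relations. -/
def leStar (a b : W) : Prop := Relation.ReflTransGen CovStar a b

/-- The finite set of all parking functions of length `n`. -/
noncomputable def pfFinset (n : ℕ) : Finset W :=
  ((Finset.univ : Finset (Fin n → Fin n)).image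
      (fun f => List.ofFn fun i => (f i).val + 1)).filter IsPF

/-- The basis element `Q_a = Σ_{a ≤_* b} M_b`. -/
noncomputable def Qb (K : Type) [Field K] (a : W) : FW K :=
  ∑ b ∈ (pfFinset a.length).filter (fun b => leStar a b), Mb K b

/-- `Q_x ⊗ Q_y` as an element of the tensor square. -/
noncomputable def QT (K : Type) [Field K] (x y : W) : FW2 K :=
  ∑ b ∈ (pfFinset x.length).filter (fun b => leStar x b),
    ∑ c ∈ (pfFinset y.length).filter (fun c => leStar y c),
      Finsupp.single (b, c) 1

/-- `a` is a nonincreasing word. -/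
def NonInc (a : W) : Prop := a.Chain' (fun x y => y ≤ x)

/-- Every word of the LR-decomposition of `a` is nondecreasing. -/
def Nprop (a : W) : Prop := ∀ w ∈ LR a, w.Chain' (· ≤ ·)

/-- The words of the LR-decomposition of `a` have pairwise disjoint sets of letters. -/
def Dprop (a : W) : Prop := (LR a).Pairwise (fun u v => ∀ x ∈ u, x ∉ v)

/-- `a` is a permutation of `{1, …, n}` viewed as a word. -/
def Sprop (a : W) : Prop := a.Perm (List.range' 1 a.length)


/-- The `⋆`-product `Q_{x₁} ⋆ Q_{x₂} ⋆ ⋯ ⋆ Q_{xₖ}` of `Q`-basis elements along a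
list; this realizes the canonical algebra map from the free associative algebra
(whose basis consists of words in the generators). -/
noncomputable def qList (K : Type) [Field K] (L : List W) : FW K :=
  L.foldr (fun x acc => starF K (Qb K x) acc) (Mb K [])

/-- first letter -/
def hd (w : W) : ℕ := w.headD 0

theorem flatten_segs (a : W) : (segs a).flatten = a := by
  induction a using segs.induct with
  | case1 => simp [segs]
  | case2 x xs ih => 
    rw [segs, List.flatten_cons, ih]
    simp [List.takeWhile_append_dropWhile]

theorem dom_segs (a : W) : ∀ w ∈ segs a, Dominated w := by
  induction a using segs.induct with
  | case1 => simp [segs]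
  | case2 x xs ih => 
    rw [segs]
    intro w hw
    rcases List.mem_cons.1 hw with rfl | hw
    · refine ⟨by simp, ?_⟩
      intro y hy
      rcases List.mem_cons.1 hy with rfl | hy
      · simp
      · simpa using List.mem_takeWhile_imp hy
    · exact ih w hw

theorem pw_segs (a : W) : (segs a).Pairwise (fun u v => hd v < hd u) := by
  induction a using segs.induct with
  | case1 => simp [segs]
  | case2 x xs ih => 
    rw [segs, List.pairwise_cons]
    refine ⟨?_, ih⟩
    intro w hw
    rcases h : xs.dropWhile (fun y => decide (x ≤ y)) with _ | ⟨y, ys⟩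
    · rw [h] at hw; simp [segs] at hw
    · have hy : y < x := by
        have := List.head?_dropWhile_not (fun y => decide (x ≤ y)) xs
        rw [h] at this
        simpa using this
      rw [h, segs] at hw ih
      rw [List.pairwise_cons] at ih
      rcases List.mem_cons.1 hw with rfl | hw
      · simpa [hd] using hy
      · have := ih.1 w hw
        simp [hd] at this ⊢
        omega

theorem segs_flatten (F : List W) (h1 : ∀ w ∈ F, Dominated w)
    (h2 : F.Pairwise (fun u v => hd v < hd u)) : segs F.flatten = F := by
  induction F with
  | nil => simp [segs]
  | cons w F ih =>
    rw [List.pairwise_cons] at h2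
    have ih := ih (fun w hw => h1 w (by simp [hw])) h2.2
    obtain ⟨hw0, hw⟩ := h1 w (by simp)
    obtain ⟨x, xs, rfl⟩ := List.exists_cons_of_ne_nil hw0
    have hxs : ∀ y ∈ xs, x ≤ y := fun y hy => by simpa using hw y (by simp [hy])
    rw [List.flatten_cons, List.cons_append, segs]
    have hF : F.flatten = [] ∨ ∃ y ys, F.flatten = y :: ys ∧ y < x := by
      rcases F with _ | ⟨v, F⟩
      · simp
      · right
        obtain ⟨hv0, hv⟩ := h1 v (by simp)
        obtain ⟨y, ys, rfl⟩ := List.exists_cons_of_ne_nil hv0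
        exact ⟨y, ys ++ F.flatten, by simp, by simpa [hd] using h2.1 (y :: ys) (by simp)⟩
    have e1 : (xs ++ F.flatten).takeWhile (fun y => decide (x ≤ y)) = xs := by
      rw [List.takeWhile_append_of_pos (by simpa using hxs)]
      rcases hF with h | ⟨y, ys, h, hy⟩
      · simp [h]
      · simp [h, hy]
    have e2 : (xs ++ F.flatten).dropWhile (fun y => decide (x ≤ y)) = F.flatten := by
      rw [List.dropWhile_append_of_pos (by simpa using hxs)]
      rcases hF with h | ⟨y, ys, h, hy⟩
      · simp [h]
      · simp [h, hy]
    rw [e1, e2, ih]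

theorem dom_LR (a : W) : ∀ w ∈ LR a, Dominated w := by
  intro w hw; exact dom_segs a w (by simpa [LR] using hw)

theorem pw_LR (a : W) : (LR a).Pairwise (fun u v => hd u < hd v) := by
  rw [LR, List.pairwise_reverse]; exact pw_segs a

theorem wordOf_LR (a : W) : (LR a).reverse.flatten = a := by
  rw [LR, List.reverse_reverse, flatten_segs]

theorem LR_wordOf (F : List W) (h1 : ∀ w ∈ F, Dominated w)
    (h2 : F.Pairwise (fun u v => hd u < hd v)) : LR F.reverse.flatten = F := by
  rw [LR, segs_flatten, List.reverse_reverse]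
  · intro w hw; exact h1 w (by simpa using hw)
  · rw [List.pairwise_reverse]; exact h2

theorem nodup_of_pw {F : List W} (h : F.Pairwise (fun u v => hd u < hd v)) : F.Nodup :=
  h.imp (fun h e => by subst e; exact lt_irrefl _ h)

theorem nodup_LR (a : W) : (LR a).Nodup := nodup_of_pw (pw_LR a)

/-- the underlying set of the LR decomposition -/
def FS (a : W) : Finset W := (LR a).toFinset

/-- a set of dominated words with distinct minima -/
def Good (G : Finset W) : Prop :=
  (∀ w ∈ G, Dominated w) ∧ ∀ u ∈ G, ∀ v ∈ G, hd u = hd v → u = v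

theorem pw_inj {F : List W} (h : F.Pairwise (fun u v => hd u < hd v)) :
    ∀ u ∈ F, ∀ v ∈ F, hd u = hd v → u = v := by
  induction F with
  | nil => simp
  | cons w F ih =>
    rw [List.pairwise_cons] at h
    intro u hu v hv e
    rcases List.mem_cons.1 hu with hu1 | hu1 <;> rcases List.mem_cons.1 hv with hv1 | hv1
    · rw [hu1, hv1]
    · have := h.1 v hv1; subst hu1; omega
    · have := h.1 u hu1; subst hv1; omega
    · exact ih h.2 u hu1 v hv1 e

theorem good_FS (a : W) : Good (FS a) := by
  refine ⟨fun w hw => dom_LR a w (by simpa [FS] using hw), fun u hu v hv => ?_⟩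
  exact pw_inj (pw_LR a) u (by simpa [FS] using hu) v (by simpa [FS] using hv)

theorem le_of_hd {u v : W} (hu : u ≠ []) (hv : v ≠ []) (h : hd u < hd v) : u ≤ v := by
  obtain ⟨x, xs, rfl⟩ := List.exists_cons_of_ne_nil hu
  obtain ⟨y, ys, rfl⟩ := List.exists_cons_of_ne_nil hv
  apply le_of_lt
  rw [List.cons_lt_cons_iff]
  left; simpa [hd] using h

theorem sort_FS (a : W) : (FS a).sort (· ≤ ·) = LR a := by
  rw [FS, List.toFinset_sort _ (nodup_LR a)]
  refine List.Pairwise.imp_of_mem ?_ (pw_LR a)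
  intro u v hu hv h
  exact le_of_hd (dom_LR a u hu).1 (dom_LR a v hv).1 h

theorem wordOfSet_FS (a : W) : wordOfSet (FS a) = a := by
  rw [wordOfSet, sort_FS, wordOf_LR]

theorem FS_inj {a b : W} (h : FS a = FS b) : a = b := by
  rw [← wordOfSet_FS a, h, wordOfSet_FS]

theorem FS_wordOfSet {G : Finset W} (hG : Good G) : FS (wordOfSet G) = G := by
  rw [FS, wordOfSet, LR_wordOf]
  · simp
  · intro w hw; exact hG.1 w (by simpa using hw)
  · have h1 := Finset.pairwise_sort G (· ≤ ·)
    have h2 := Finset.sort_nodup G (· ≤ ·)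
    refine List.Pairwise.imp_of_mem ?_ (h1.and h2)
    intro u v hu hv h
    have hu' : u ∈ G := by simpa using hu
    have hv' : v ∈ G := by simpa using hv
    by_contra hlt
    have hne : hd u ≠ hd v := fun e => h.2 (hG.2 u hu' v hv' e)
    have := le_of_hd (hG.1 v hv').1 (hG.1 u hu').1 (by omega)
    exact h.2 (le_antisymm h.1 this)

theorem FS_of_list (F : List W) (h1 : ∀ w ∈ F, Dominated w)
    (h2 : F.Pairwise (fun u v => hd u < hd v)) : FS F.reverse.flatten = F.toFinset := by
  rw [FS, LR_wordOf F h1 h2]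

/-- merging relation on sets of words -/
def Mrg (G G' : Finset W) : Prop :=
  ∃ u ∈ G, ∃ v ∈ G, u ≠ v ∧ (∀ x ∈ u, ∀ y ∈ v, x ≤ y) ∧
    G' = insert (u ++ v) ((G.erase u).erase v)

theorem hd_append {u v : W} (hu : u ≠ []) : hd (u ++ v) = hd u := by
  obtain ⟨x, xs, rfl⟩ := List.exists_cons_of_ne_nil hu
  rfl

theorem hd_mem {u : W} (hu : u ≠ []) : hd u ∈ u := by
  obtain ⟨x, xs, rfl⟩ := List.exists_cons_of_ne_nil hu
  simp [hd]

theorem dom_append {u v : W} (hu : Dominated u) (h : ∀ x ∈ u, ∀ y ∈ v, x ≤ y) :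
    Dominated (u ++ v) := by
  refine ⟨by simp [hu.1], ?_⟩
  intro x hx
  change hd (u ++ v) ≤ x
  rw [hd_append hu.1]
  rcases List.mem_append.1 hx with hx | hx
  · exact hu.2 x hx
  · exact h _ (hd_mem hu.1) x hx

theorem Mrg.good {G G' : Finset W} (h : Mrg G G') (hG : Good G) : Good G' := by
  obtain ⟨u, hu, v, hv, huv, hle, rfl⟩ := h
  have key : ∀ w ∈ (G.erase u).erase v, w ∈ G ∧ hd w ≠ hd (u ++ v) := by
    intro w hw
    simp only [Finset.mem_erase] at hw
    refine ⟨hw.2.2, ?_⟩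
    rw [hd_append (hG.1 u hu).1]
    exact fun e => hw.2.1 (hG.2 w hw.2.2 u hu e)
  constructor
  · intro w hw
    rcases Finset.mem_insert.1 hw with rfl | hw
    · exact dom_append (hG.1 u hu) hle
    · exact hG.1 w (key w hw).1
  · intro w hw w' hw' e
    rcases Finset.mem_insert.1 hw with rfl | hw <;> rcases Finset.mem_insert.1 hw' with rfl | hw'
    · rfl
    · exact absurd e.symm (key w' hw').2
    · exact absurd e (key w hw).2
    · exact hG.2 w (key w hw).1 w' (key w' hw').1 e

theorem list_merge_toFinset {l : List W} (hl : l.Nodup) {i j : ℕ} (hij : i ≠ j)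
    (hi : i < l.length) (hj : j < l.length) (z : W) :
    ((l.set i z).eraseIdx j).toFinset = insert z ((l.toFinset.erase l[i]).erase l[j]) := by
  ext w
  simp only [List.mem_toFinset, List.mem_eraseIdx_iff_getElem?, Finset.mem_insert,
    Finset.mem_erase, List.getElem?_set]
  constructor
  · rintro ⟨k, hk, h⟩
    split_ifs at h with h1
    · left; simpa using h.symm
    · right
      obtain ⟨hk', rfl⟩ := List.getElem?_eq_some_iff.1 h
      refine ⟨?_, ?_, List.getElem_mem _⟩
      · rw [Ne, hl.getElem_inj_iff]; exact hk
      · rw [Ne, hl.getElem_inj_iff]; exact fun e => h1 e.symm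
  · rintro (rfl | ⟨h1, h2, h3⟩)
    · exact ⟨i, hij, by simp [hi]⟩
    · obtain ⟨k, hk, rfl⟩ := List.mem_iff_getElem.1 h3
      refine ⟨k, fun e => h1 (by subst e; rfl), ?_⟩
      rw [if_neg (fun e => h2 (by subst e; rfl))]
      simp

theorem pw_merge {l : List W} (hl : l.Pairwise (fun u v => hd u < hd v)) {i j : ℕ}
    (hi : i < l.length) (z : W) (hz : hd z = hd l[i]) :
    ((l.set i z).eraseIdx j).Pairwise (fun u v => hd u < hd v) := by
  refine List.Pairwise.sublist (List.eraseIdx_sublist _ _) ?_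
  have : (l.set i z).map hd = l.map hd := by
    rw [List.map_set, hz, ← List.getElem_map hd (h := by simpa using hi), List.set_getElem_self]
  have h2 : (l.map hd).Pairwise (· < ·) := by rw [List.pairwise_map]; exact hl
  rw [← this, List.pairwise_map] at h2
  exact h2

theorem covStar_iff (a b : W) : CovStar a b ↔ Mrg (FS a) (FS b) := by
  constructor
  · rintro ⟨i, j, hij, hj, hle, hb⟩
    have hi : i < (LR a).length := by omega
    rw [List.getD_eq_getElem _ _ hi, List.getD_eq_getElem _ _ hj] at *
    refine ⟨(LR a)[i], by simp [FS], (LR a)[j], by simp [FS], ?_, hle, ?_⟩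
    · rw [Ne, (nodup_LR a).getElem_inj_iff]; omega
    · rw [FS, hb, list_merge_toFinset (nodup_LR a) (by omega) hi hj]; rfl
  · rintro ⟨u, hu, v, hv, huv, hle, hb⟩
    obtain ⟨i, hi, rfl⟩ := List.mem_iff_getElem.1 (List.mem_toFinset.1 hu)
    obtain ⟨j, hj, rfl⟩ := List.mem_iff_getElem.1 (List.mem_toFinset.1 hv)
    have hdi := dom_LR a _ (List.getElem_mem hi)
    have hdj := dom_LR a _ (List.getElem_mem hj)
    have hlt : i < j := by
      by_contra hcon
      have hji : j < i := by
        have : i ≠ j := fun e => huv (by subst e; rfl)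
        omega
      have h1 := List.pairwise_iff_getElem.1 (pw_LR a) j i hj hi hji
      have h2 := hle _ (hd_mem hdi.1) _ (hd_mem hdj.1)
      omega
    refine ⟨i, j, hlt, hj, ?_, ?_⟩
    · rwa [List.getD_eq_getElem _ _ hi, List.getD_eq_getElem _ _ hj]
    · rw [List.getD_eq_getElem _ _ hi, List.getD_eq_getElem _ _ hj]
      rw [FS, FS, ← list_merge_toFinset (nodup_LR a) (by omega) hi hj] at hb
      have hpw := pw_merge (pw_LR a) (j := j) hi ((LR a)[i] ++ (LR a)[j]) (hd_append hdi.1)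
      have hdom : ∀ w ∈ ((LR a).set i ((LR a)[i] ++ (LR a)[j])).eraseIdx j, Dominated w := by
        intro w hw
        have := List.mem_of_mem_eraseIdx hw
        rcases List.mem_or_eq_of_mem_set this with h | rfl
        · exact dom_LR a w h
        · exact dom_append hdi hle
      have h3 := FS_of_list _ hdom hpw
      rw [← hb] at h3
      have h4 := FS_inj (b := b) h3
      rw [← h4, LR_wordOf _ hdom hpw]

theorem rtg_mrg {a : W} {G : Finset W} (h : Relation.ReflTransGen Mrg (FS a) G) :
    Good G ∧ leStar a (wordOfSet G) := by
  induction h with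
  | refl => exact ⟨good_FS a, by rw [wordOfSet_FS]; exact .refl⟩
  | tail _ h ih =>
    have hg := h.good ih.1
    refine ⟨hg, ih.2.tail ?_⟩
    rw [covStar_iff, FS_wordOfSet ih.1, FS_wordOfSet hg]
    exact h

theorem leStar_iff (a b : W) : leStar a b ↔ Relation.ReflTransGen Mrg (FS a) (FS b) := by
  constructor
  · intro h
    unfold leStar at h
    exact Relation.ReflTransGen.lift FS (fun x y h => (covStar_iff x y).1 h) _ _ h
  · intro h
    have := (rtg_mrg h).2
    rwa [wordOfSet_FS] at this

theorem mset_eq (a : W) : (a : Multiset ℕ) = ∑ w ∈ FS a, (w : Multiset ℕ) := by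
  rw [FS, List.sum_toFinset _ (nodup_LR a)]
  conv_lhs => rw [← wordOf_LR a]
  generalize LR a = F
  induction F with
  | nil => simp
  | cons w F ih =>
    rw [List.map_cons, List.sum_cons, ← ih]
    simp only [List.reverse_cons, List.flatten_append, List.flatten_cons, List.flatten_nil,
      List.append_nil, ← Multiset.coe_add]
    rw [add_comm]

theorem Mrg.not_mem {G : Finset W} (hG : Good G) {u v : W} (hu : u ∈ G) (hv : v ∈ G) (huv : u ≠ v) :
    u ++ v ∉ (G.erase u).erase v := by
  intro h
  simp only [Finset.mem_erase] at h
  exact h.2.1 (hG.2 _ h.2.2 u hu (hd_append (hG.1 u hu).1))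

theorem Mrg.sum {G G' : Finset W} (h : Mrg G G') (hG : Good G) :
    ∑ w ∈ G', (w : Multiset ℕ) = ∑ w ∈ G, (w : Multiset ℕ) := by
  obtain ⟨u, hu, v, hv, huv, hle, rfl⟩ := h
  rw [Finset.sum_insert (Mrg.not_mem hG hu hv huv), ← Multiset.coe_add, add_assoc,
    Finset.add_sum_erase _ _ (by simp [hv, huv.symm] : v ∈ G.erase u), Finset.add_sum_erase _ _ hu]

theorem Mrg.card {G G' : Finset W} (h : Mrg G G') (hG : Good G) : G'.card < G.card := by
  obtain ⟨u, hu, v, hv, huv, hle, rfl⟩ := h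
  rw [Finset.card_insert_of_notMem (Mrg.not_mem hG hu hv huv),
    Finset.card_erase_of_mem (by simp [hv, huv.symm]), Finset.card_erase_of_mem hu]
  have : 1 < G.card := Finset.one_lt_card.2 ⟨u, hu, v, hv, huv⟩
  omega

theorem covStar_perm {a b : W} (h : CovStar a b) : b.Perm a := by
  rw [← Multiset.coe_eq_coe, mset_eq, mset_eq a]
  exact ((covStar_iff a b).1 h).sum (good_FS a)

theorem leStar_perm {a b : W} (h : leStar a b) : b.Perm a := by
  unfold leStar at h
  induction h with
  | refl => exact List.Perm.refl _
  | tail _ h ih => exact (covStar_perm h).trans ih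

theorem leStar_card {a b : W} (h : leStar a b) : a = b ∨ (FS b).card < (FS a).card := by
  unfold leStar at h
  induction h with
  | refl => exact Or.inl rfl
  | tail _ h ih =>
    right
    have := ((covStar_iff _ _).1 h).card (good_FS _)
    rcases ih with rfl | ih
    · exact this
    · omega

theorem isPF_perm {a b : W} (h : a.Perm b) (hb : IsPF b) : IsPF a := by
  have e : a.insertionSort (· ≤ ·) = b.insertionSort (· ≤ ·) :=
    List.Perm.eq_of_pairwise (fun x y _ _ h1 h2 => le_antisymm h1 h2)
      (List.pairwise_insertionSort _ _) (List.pairwise_insertionSort _ _)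
      ((List.perm_insertionSort _ _).trans (h.trans (List.perm_insertionSort _ _).symm))
  refine ⟨fun x hx => hb.1 x (h.mem_iff.1 hx), ?_⟩
  rw [e, h.length_eq]; exact hb.2

theorem isPF_iff (a : W) : IsPF a ↔ (∀ x ∈ a, 1 ≤ x) ∧
    ∀ i ≤ a.length, i ≤ a.countP (fun x => decide (x ≤ i)) := by
  have hp := List.perm_insertionSort (· ≤ ·) a
  have hs := List.pairwise_insertionSort (· ≤ ·) a
  unfold IsPF
  refine and_congr_right fun _ => ?_
  have hc : ∀ i, a.countP (fun x => decide (x ≤ i)) =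
    (a.insertionSort (· ≤ ·)).countP (fun x => decide (x ≤ i)) := fun i => (hp.countP_eq _).symm
  simp only [hc]
  rw [← hp.length_eq]
  generalize a.insertionSort (· ≤ ·) = s at hs
  constructor
  · intro h i hi
    calc i = (s.take i).length := by simp [hi]
      _ = (s.take i).countP (fun x => decide (x ≤ i)) := by
          symm
          rw [List.countP_eq_length]
          intro x hx
          obtain ⟨k, hk, rfl⟩ := List.mem_iff_getElem.1 hx
          simp at hk
          have := h k (by omega)
          rw [List.getD_eq_getElem _ _ (by omega)] at this
          simp; omega
      _ ≤ _ := (List.take_sublist i s).countP_le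
  · intro h i hi
    by_contra hcon
    rw [List.getD_eq_getElem _ _ hi] at hcon
    have h1 := h (i+1) (by omega)
    rw [← List.take_append_drop i s, List.countP_append] at h1
    have h2 : (s.drop i).countP (fun x => decide (x ≤ i+1)) = 0 := by
      rw [List.countP_eq_zero]
      intro x hx
      obtain ⟨k, hk, rfl⟩ := List.mem_iff_getElem.1 hx
      simp at hk
      simp only [List.getElem_drop, decide_eq_true_eq, not_le]
      rcases Nat.eq_zero_or_pos k with rfl | hk0
      · simpa using hcon
      · have := List.pairwise_iff_getElem.1 hs i (i+k) hi (by omega) (by omega)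
        omega
    have h3 := List.countP_le_length (p := fun x => decide (x ≤ i+1)) (l := s.take i)
    simp at h3
    omega

theorem pf_le {a : W} (h : IsPF a) : ∀ x ∈ a, x ≤ a.length := by
  have h1 := ((isPF_iff a).1 h).2 _ le_rfl
  have h2 := List.countP_eq_length.1 (le_antisymm List.countP_le_length h1)
  intro x hx; simpa using h2 x hx

theorem countP_le_len {a : W} (h : IsPF a) {i : ℕ} (hi : a.length ≤ i) :
    a.countP (fun x => decide (x ≤ i)) = a.length := by
  rw [List.countP_eq_length]
  intro x hx
  have := pf_le h x hx
  simp; omega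

theorem countP_shift (m j : ℕ) (b : W) : (shiftW m b).countP (fun x => decide (x ≤ m + j)) =
    b.countP (fun x => decide (x ≤ j)) := by
  rw [shiftW, List.countP_map]
  congr 1
  funext x
  simp only [Function.comp, decide_eq_decide]
  omega

theorem length_shiftW (m : ℕ) (b : W) : (shiftW m b).length = b.length := by simp [shiftW]

theorem length_slash (a b : W) : (slashProd a b).length = a.length + b.length := by
  simp [slashProd, length_shiftW, add_comm]

theorem pf_slash {a b : W} (ha : IsPF a) (hb : IsPF b) : IsPF (slashProd a b) := by
  rw [isPF_iff]
  constructor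
  · intro x hx
    rcases List.mem_append.1 hx with hx | hx
    · obtain ⟨y, hy, rfl⟩ := List.mem_map.1 hx
      have := hb.1 y hy
      omega
    · exact ha.1 x hx
  · intro i hi
    rw [length_slash] at hi
    rw [slashProd, List.countP_append]
    rcases le_total i a.length with h | h
    · have := ((isPF_iff a).1 ha).2 i h
      omega
    · obtain ⟨j, rfl⟩ := Nat.exists_eq_add_of_le h
      rw [countP_shift, countP_le_len ha h]
      have := ((isPF_iff b).1 hb).2 j (by omega)
      omega

theorem pf_of_slash {a b : W} (ha : IsPF a) (hab : IsPF (slashProd a b)) (hpos : ∀ x ∈ b, 1 ≤ x) :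
    IsPF b := by
  rw [isPF_iff]
  refine ⟨hpos, fun i hi => ?_⟩
  have := ((isPF_iff _).1 hab).2 (a.length + i) (by rw [length_slash]; omega)
  rw [slashProd, List.countP_append, countP_shift, countP_le_len ha (by omega)] at this
  omega

theorem mem_pfFinset (n : ℕ) (a : W) : a ∈ pfFinset n ↔ IsPF a ∧ a.length = n := by
  unfold pfFinset
  simp only [Finset.mem_filter, Finset.mem_image, Finset.mem_univ, true_and]
  constructor
  · rintro ⟨⟨f, rfl⟩, h⟩
    exact ⟨h, by simp⟩
  · rintro ⟨h, rfl⟩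
    refine ⟨⟨fun i => ⟨a[i] - 1, ?_⟩, ?_⟩, h⟩
    · have := pf_le h a[i] (List.getElem_mem _)
      have := h.1 a[i] (List.getElem_mem _)
      omega
    · apply List.ext_getElem
      · simp
      · intro i h1 h2
        have := h.1 a[i] (List.getElem_mem _)
        simp
        omega

theorem leStar_pf {a b : W} (ha : IsPF a) (h : leStar a b) : IsPF b :=
  isPF_perm (leStar_perm h) ha

theorem mem_Qset {a b : W} (ha : IsPF a) :
    b ∈ (pfFinset a.length).filter (fun b => leStar a b) ↔ leStar a b := by
  rw [Finset.mem_filter, mem_pfFinset]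
  exact ⟨fun h => h.2, fun h => ⟨⟨leStar_pf ha h, (leStar_perm h).length_eq⟩, h⟩⟩

/-! ### slash factorization -/

theorem shiftW_inj {m : ℕ} {a b : W} (h : shiftW m a = shiftW m b) : a = b :=
  List.map_injective_iff.2 (fun x y h => by simpa using h) h

theorem slash_assoc (a b c : W) :
    slashProd (slashProd a b) c = slashProd a (slashProd b c) := by
  have : (fun x : ℕ => x + (b.length + a.length)) = (fun x => x + b.length + a.length) := by
    funext x; omega
  simp [slashProd, shiftW, this]

/-- iterated slash product -/
def slashL (L : List W) : W := L.foldr slashProd []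

theorem nil_pf : IsPF [] := by simp [IsPF]

theorem slash_nil_left (a : W) : slashProd [] a = a := by simp [slashProd, shiftW]

theorem slashL_append (L₁ L₂ : List W) :
    slashL (L₁ ++ L₂) = slashProd (slashL L₁) (slashL L₂) := by
  induction L₁ with
  | nil => simp [slashL, slash_nil_left]
  | cons x L ih =>
    change slashProd x (slashL (L ++ L₂)) = slashProd (slashProd x (slashL L)) _
    rw [ih, slash_assoc]

theorem slashL_pf {L : List W} (h : ∀ x ∈ L, AtomicPF x) : IsPF (slashL L) := by
  induction L with
  | nil => exact nil_pf
  | cons x L ih => exact pf_slash (h x (by simp)).1 (ih fun y hy => h y (by simp [hy]))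

theorem exists_atomic (a : W) (h : IsPF a) : ∃ L : List W, (∀ x ∈ L, AtomicPF x) ∧ slashL L = a := by
  induction hn : a.length using Nat.strong_induction_on generalizing a with
  | _ n ih =>
    subst hn
    by_cases h0 : a = []
    · exact ⟨[], by simp, by simp [slashL, h0]⟩
    by_cases hat : AtomicPF a
    · exact ⟨[a], by simpa using hat, by simp [slashL, slashProd, shiftW]⟩
    · unfold AtomicPF at hat
      push Not at hat
      obtain ⟨b, c, hb, hc, hb0, hc0, e⟩ := hat h h0
      have hl : a.length = b.length + c.length := by rw [e, length_slash]
      have h1 := List.length_pos_of_ne_nil hb0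
      have h2 := List.length_pos_of_ne_nil hc0
      obtain ⟨L, hL, rfl⟩ := ih _ (by omega) b hb rfl
      obtain ⟨L', hL', rfl⟩ := ih _ (by omega) c hc rfl
      refine ⟨L ++ L', ?_, by rw [slashL_append, e]⟩
      intro x hx
      rcases List.mem_append.1 hx with hx | hx
      · exact hL x hx
      · exact hL' x hx

theorem slash_aux {x x' s s' : W} (hx : IsPF x) (hx0 : x ≠ []) (hx' : AtomicPF x')
    (hs : ∀ y ∈ s, 1 ≤ y)
    (h : slashProd x s = slashProd x' s') : ¬ x.length < x'.length := by
  intro hlt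
  unfold slashProd at h
  rcases List.append_eq_append_iff.1 h with ⟨as, h1, h2⟩ | ⟨bs, h1, h2⟩
  · have := congrArg List.length h2
    simp at this; omega
  · have hb : ∃ y : W, bs = shiftW x.length y ∧ ∀ z ∈ y, 1 ≤ z := by
      unfold shiftW at h1
      obtain ⟨s1, s2, rfl, -, h3⟩ := List.map_eq_append_iff.1 h1
      exact ⟨s2, h3.symm, fun z hz => hs z (by simp [hz])⟩
    obtain ⟨y, rfl, hy⟩ := hb
    refine hx'.2.2 ⟨x, y, hx, pf_of_slash hx (by rw [slashProd, ← h2]; exact hx'.1) hy, hx0, ?_, h2⟩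
    rintro rfl
    have := congrArg List.length h2
    simp [shiftW] at this; omega

theorem slashL_inj {L L' : List W} (hL : ∀ x ∈ L, AtomicPF x) (hL' : ∀ x ∈ L', AtomicPF x)
    (h : slashL L = slashL L') : L = L' := by
  induction L generalizing L' with
  | nil =>
    rcases L' with _ | ⟨x', L'⟩
    · rfl
    · have := congrArg List.length h
      have h2 := List.length_pos_of_ne_nil (hL' x' (by simp)).2.1
      simp [slashL, length_slash] at this
      omega
  | cons x L ih =>
    rcases L' with _ | ⟨x', L'⟩
    · have := congrArg List.length h
      have h2 := List.length_pos_of_ne_nil (hL x (by simp)).2.1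
      simp [slashL, length_slash] at this
      simp [this.1] at h2
    · change slashProd x (slashL L) = slashProd x' (slashL L') at h
      have ax := hL x (by simp)
      have ax' := hL' x' (by simp)
      have aL : ∀ y ∈ L, AtomicPF y := fun y hy => hL y (by simp [hy])
      have aL' : ∀ y ∈ L', AtomicPF y := fun y hy => hL' y (by simp [hy])
      have h1 := slash_aux ax.1 ax.2.1 ax' (slashL_pf aL).1 h
      have h2 := slash_aux ax'.1 ax'.2.1 ax (slashL_pf aL').1 h.symm
      have hl : x.length = x'.length := by omega
      have h3 := h
      unfold slashProd at h3
      obtain ⟨h4, h5⟩ := List.append_inj' h3 hl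
      rw [hl] at h4
      rw [h5, ih aL aL' (shiftW_inj h4)]

/-- shifted LR set -/
def SFS (m : ℕ) (b : W) : Finset W := (FS b).image (shiftW m)

theorem shiftF_toFinset (m : ℕ) (b : W) : (shiftF m (LR b)).toFinset = SFS m b := by
  ext w; simp [shiftF, SFS, FS]

theorem shiftW_nil_iff {m : ℕ} {w : W} : shiftW m w = [] ↔ w = [] := by simp [shiftW]

theorem hd_shift {m : ℕ} {w : W} (h : w ≠ []) : hd (shiftW m w) = hd w + m := by
  obtain ⟨x, xs, rfl⟩ := List.exists_cons_of_ne_nil h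
  simp [hd, shiftW]

theorem dom_shift {m : ℕ} {w : W} (h : Dominated w) : Dominated (shiftW m w) := by
  refine ⟨by rw [Ne, shiftW_nil_iff]; exact h.1, ?_⟩
  intro x hx
  change hd _ ≤ x
  rw [hd_shift h.1]
  obtain ⟨y, hy, rfl⟩ := List.mem_map.1 hx
  have := h.2 y hy
  change hd w ≤ y at this
  omega

theorem mem_of_FS {a w : W} (hw : w ∈ FS a) {x : ℕ} (hx : x ∈ w) : x ∈ a := by
  rw [← wordOf_LR a]
  simp only [List.mem_flatten, List.mem_reverse]
  exact ⟨w, by simpa [FS] using hw, hx⟩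

theorem FS_le {a w : W} (ha : IsPF a) (hw : w ∈ FS a) : ∀ x ∈ w, x ≤ a.length :=
  fun x hx => pf_le ha x (mem_of_FS hw hx)

theorem SFS_lt {m : ℕ} {b w : W} (hb : IsPF b) (hw : w ∈ SFS m b) : ∀ x ∈ w, m < x := by
  intro x hx
  obtain ⟨v, hv, rfl⟩ := Finset.mem_image.1 hw
  obtain ⟨y, hy, rfl⟩ := List.mem_map.1 hx
  have := hb.1 y (mem_of_FS hv hy)
  omega

theorem SFS_good (m : ℕ) (b : W) : Good (SFS m b) := by
  have hg := good_FS b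
  constructor
  · intro w hw
    obtain ⟨v, hv, rfl⟩ := Finset.mem_image.1 hw
    exact dom_shift (hg.1 v hv)
  · intro u hu v hv e
    obtain ⟨u, hu1, rfl⟩ := Finset.mem_image.1 hu
    obtain ⟨v, hv1, rfl⟩ := Finset.mem_image.1 hv
    rw [hd_shift (hg.1 u hu1).1, hd_shift (hg.1 v hv1).1] at e
    rw [hg.2 u hu1 v hv1 (by omega)]

theorem FS_slash {a b : W} (ha : IsPF a) (hb : IsPF b) :
    FS (slashProd a b) = FS a ∪ SFS a.length b := by
  have e : (LR a ++ shiftF a.length (LR b)).reverse.flatten = slashProd a b := by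
    rw [List.reverse_append, List.flatten_append, wordOf_LR, slashProd]
    congr 1
    conv_rhs => rw [← wordOf_LR b]
    simp [shiftF, shiftW, List.map_flatten, List.map_reverse]
    rfl
  rw [← e, FS_of_list, List.toFinset_append, shiftF_toFinset, FS]
  · intro w hw
    rcases List.mem_append.1 hw with hw | hw
    · exact dom_LR a w hw
    · obtain ⟨v, hv, rfl⟩ := List.mem_map.1 hw
      exact dom_shift (dom_LR b v hv)
  · rw [List.pairwise_append]
    refine ⟨pw_LR a, ?_, ?_⟩
    · rw [shiftF, List.pairwise_map]
      refine List.Pairwise.imp_of_mem ?_ (pw_LR b)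
      intro u v hu hv h
      rw [hd_shift (dom_LR b u hu).1, hd_shift (dom_LR b v hv).1]
      omega
    · intro u hu v hv
      have hu' : u ∈ FS a := by simpa [FS] using hu
      have hv' : v ∈ SFS a.length b := by rw [← shiftF_toFinset]; simpa using hv
      have h1 := FS_le ha hu' _ (hd_mem (dom_LR a u hu).1)
      have h2 := SFS_lt hb hv' _ (hd_mem ((SFS_good _ b).1 v hv').1)
      omega

/-! ### matchings -/

/-- hypotheses on a gluing configuration -/
structure Cfg (m : ℕ) (X Y : Finset W) : Prop where
  gX : Good X
  gY : Good Y
  lX : ∀ w ∈ X, ∀ x ∈ w, x ≤ m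
  lY : ∀ w ∈ Y, ∀ x ∈ w, m < x

/-- matchings -/
def Mat (X Y : Finset W) (Θ : Finset (W × W)) : Prop :=
  Θ ⊆ X ×ˢ Y ∧ ∀ p ∈ Θ, ∀ q ∈ Θ, (p.1 = q.1 ∨ p.2 = q.2) → p = q

theorem Cfg.hd_ne {m : ℕ} {X Y : Finset W} (h : Cfg m X Y) {u v : W} (hu : u ∈ X) (hv : v ∈ Y) :
    hd u ≠ hd v := by
  have h1 := h.lX u hu _ (hd_mem (h.gX.1 u hu).1)
  have h2 := h.lY v hv _ (hd_mem (h.gY.1 v hv).1)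
  omega

theorem Cfg.good {m : ℕ} {X Y : Finset W} (h : Cfg m X Y) : Good (X ∪ Y) := by
  constructor
  · intro w hw
    rcases Finset.mem_union.1 hw with hw | hw
    · exact h.gX.1 w hw
    · exact h.gY.1 w hw
  · intro u hu v hv e
    rcases Finset.mem_union.1 hu with hu | hu <;> rcases Finset.mem_union.1 hv with hv | hv
    · exact h.gX.2 u hu v hv e
    · exact absurd e (h.hd_ne hu hv)
    · exact absurd e.symm (h.hd_ne hv hu)
    · exact h.gY.2 u hu v hv e

theorem mem_glue {X Y : Finset W} {Θ : Finset (W × W)} {w : W} : w ∈ glueSet X Y Θ ↔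
    (∃ p ∈ Θ, p.1 ++ p.2 = w) ∨ (w ∈ X ∧ ∀ p ∈ Θ, p.1 ≠ w) ∨ (w ∈ Y ∧ ∀ p ∈ Θ, p.2 ≠ w) := by
  simp only [glueSet, Finset.mem_union, Finset.mem_image, Finset.mem_filter, or_assoc]

theorem glue_empty (X Y : Finset W) : glueSet X Y ∅ = X ∪ Y := by
  ext w; simp [mem_glue]

theorem glue_rtg {m : ℕ} {X Y : Finset W} (h : Cfg m X Y) (Θ : Finset (W × W)) (hΘ : Mat X Y Θ) :
    Relation.ReflTransGen Mrg (X ∪ Y) (glueSet X Y Θ) := by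
  induction Θ using Finset.induction_on with
  | empty => rw [glue_empty]
  | insert e Θ he ih =>
    obtain ⟨u, v⟩ := e
    have hM : Mat X Y Θ := ⟨fun p hp => hΘ.1 (by simp [hp]), fun p hp q hq =>
      hΘ.2 p (by simp [hp]) q (by simp [hq])⟩
    have huv := Finset.mem_product.1 (hΘ.1 (Finset.mem_insert_self _ _))
    have hu : u ∈ X := huv.1
    have hv : v ∈ Y := huv.2
    have h1 : ∀ p ∈ Θ, p.1 ≠ u := fun p hp e => he (by
      rw [← hΘ.2 p (by simp [hp]) (u, v) (by simp) (Or.inl e)]; exact hp)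
    have h2 : ∀ p ∈ Θ, p.2 ≠ v := fun p hp e => he (by
      rw [← hΘ.2 p (by simp [hp]) (u, v) (by simp) (Or.inr e)]; exact hp)
    have huY : u ∉ Y := fun hh => h.hd_ne hu hh rfl
    have hvX : v ∉ X := fun hh => h.hd_ne hh hv rfl
    refine (ih hM).tail ⟨u, mem_glue.2 (Or.inr (Or.inl ⟨hu, h1⟩)), v,
      mem_glue.2 (Or.inr (Or.inr ⟨hv, h2⟩)), fun e => h.hd_ne hu hv (by rw [e]), ?_, ?_⟩
    · intro x hx y hy
      have := h.lX u hu x hx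
      have := h.lY v hv y hy
      omega
    · have hpu : ∀ p ∈ Θ, p.1 ++ p.2 ≠ u ∧ p.1 ++ p.2 ≠ v := by
        intro p hp
        have hp' := Finset.mem_product.1 (hM.1 hp)
        have hne := (h.gX.1 _ hp'.1).1
        constructor
        · intro e
          have : hd p.1 = hd u := by rw [← e, hd_append hne]
          exact h1 p hp (h.gX.2 _ hp'.1 _ hu this)
        · intro e
          have : hd p.1 = hd v := by rw [← e, hd_append hne]
          exact h.hd_ne hp'.1 hv this
      ext w
      simp only [Finset.mem_insert, Finset.mem_erase, mem_glue, exists_eq_or_imp, forall_eq_or_imp]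
      constructor
      · rintro ((h3 | ⟨p, hp, rfl⟩) | ⟨hw, h3, h4⟩ | ⟨hw, h3, h4⟩)
        · exact Or.inl h3.symm
        · exact Or.inr ⟨(hpu p hp).2, (hpu p hp).1, Or.inl ⟨p, hp, rfl⟩⟩
        · exact Or.inr ⟨fun e => hvX (e ▸ hw), fun e => h3 e.symm, Or.inr (Or.inl ⟨hw, h4⟩)⟩
        · exact Or.inr ⟨fun e => h3 e.symm, fun e => huY (e ▸ hw), Or.inr (Or.inr ⟨hw, h4⟩)⟩
      · rintro (h3 | ⟨h3, h4, h5 | ⟨hw, h5⟩ | ⟨hw, h5⟩⟩)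
        · exact Or.inl (Or.inl h3.symm)
        · exact Or.inl (Or.inr h5)
        · exact Or.inr (Or.inl ⟨hw, fun e => h4 e.symm, h5⟩)
        · exact Or.inr (Or.inr ⟨hw, fun e => h3 e.symm, h5⟩)

theorem rtg_good {G G' : Finset W} (h : Relation.ReflTransGen Mrg G G') (hG : Good G) : Good G' := by
  induction h with
  | refl => exact hG
  | tail _ h ih => exact h.good ih

theorem glue_good {m : ℕ} {X Y : Finset W} (h : Cfg m X Y) (Θ : Finset (W × W))
    (hΘ : Mat X Y Θ) : Good (glueSet X Y Θ) := rtg_good (glue_rtg h Θ hΘ) h.good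

/-- low part -/
def low (m : ℕ) (w : W) : W := w.filter (fun x => decide (x ≤ m))
/-- high part -/
def high (m : ℕ) (w : W) : W := w.filter (fun x => decide (m < x))
/-- nonempty images -/
def fS (f : W → W) (G : Finset W) : Finset W := (G.image f).erase []
/-- recovered matching -/
def thS (m : ℕ) (G : Finset W) : Finset (W × W) :=
  (G.image fun w => (low m w, high m w)).filter fun p => p.1 ≠ [] ∧ p.2 ≠ []

theorem low_of_le {m : ℕ} {w : W} (h : ∀ x ∈ w, x ≤ m) : low m w = w ∧ high m w = [] := by
  simp [low, high]; exact h
theorem low_of_gt {m : ℕ} {w : W} (h : ∀ x ∈ w, m < x) : low m w = [] ∧ high m w = w := by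
  simp [low, high]; exact h
theorem low_append (m : ℕ) (u v : W) : low m (u ++ v) = low m u ++ low m v := by simp [low]
theorem high_append (m : ℕ) (u v : W) : high m (u ++ v) = high m u ++ high m v := by simp [high]

theorem mem_fS {f : W → W} {G : Finset W} {w : W} : w ∈ fS f G ↔ w ≠ [] ∧ ∃ v ∈ G, f v = w := by
  simp [fS]

theorem glue_cases {m : ℕ} {X Y : Finset W} (h : Cfg m X Y) {Θ : Finset (W × W)}
    (hΘ : Mat X Y Θ) {w : W} (hw : w ∈ glueSet X Y Θ) :
    ((low m w, high m w) ∈ Θ) ∨ (low m w ∈ X ∧ high m w = []) ∨ (low m w = [] ∧ high m w ∈ Y) := by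
  rcases mem_glue.1 hw with ⟨p, hp, rfl⟩ | ⟨hw, h1⟩ | ⟨hw, h1⟩
  · have hp' := Finset.mem_product.1 (hΘ.1 hp)
    have e1 := low_of_le (h.lX _ hp'.1)
    have e2 := low_of_gt (h.lY _ hp'.2)
    left
    rw [low_append, high_append, e1.1, e1.2, e2.1, e2.2]
    simpa using hp
  · have e1 := low_of_le (h.lX _ hw)
    exact Or.inr (Or.inl ⟨by rwa [e1.1], e1.2⟩)
  · have e1 := low_of_gt (h.lY _ hw)
    exact Or.inr (Or.inr ⟨e1.1, by rwa [e1.2]⟩)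

theorem Cfg.pair {m : ℕ} {X Y : Finset W} (h : Cfg m X Y) {Θ : Finset (W × W)}
    (hΘ : Mat X Y Θ) {p : W × W} (hp : p ∈ Θ) :
    p.1 ++ p.2 ∈ glueSet X Y Θ ∧ low m (p.1 ++ p.2) = p.1 ∧ high m (p.1 ++ p.2) = p.2 := by
  have hp' := Finset.mem_product.1 (hΘ.1 hp)
  have e1 := low_of_le (h.lX _ hp'.1)
  have e2 := low_of_gt (h.lY _ hp'.2)
  refine ⟨mem_glue.2 (Or.inl ⟨p, hp, rfl⟩), ?_⟩
  rw [low_append, high_append, e1.1, e1.2, e2.1, e2.2]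
  simp

theorem low_glue {m : ℕ} {X Y : Finset W} (h : Cfg m X Y) {Θ : Finset (W × W)}
    (hΘ : Mat X Y Θ) : fS (low m) (glueSet X Y Θ) = X := by
  ext w
  rw [mem_fS]
  constructor
  · rintro ⟨h0, v, hv, rfl⟩
    rcases glue_cases h hΘ hv with h1 | h1 | h1
    · exact (Finset.mem_product.1 (hΘ.1 h1)).1
    · exact h1.1
    · exact absurd h1.1 h0
  · intro hw
    refine ⟨(h.gX.1 w hw).1, ?_⟩
    by_cases hm : ∃ p ∈ Θ, p.1 = w
    · obtain ⟨p, hp, rfl⟩ := hm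
      exact ⟨_, (h.pair hΘ hp).1, (h.pair hΘ hp).2.1⟩
    · push Not at hm
      exact ⟨w, mem_glue.2 (Or.inr (Or.inl ⟨hw, hm⟩)), (low_of_le (h.lX w hw)).1⟩

theorem high_glue {m : ℕ} {X Y : Finset W} (h : Cfg m X Y) {Θ : Finset (W × W)}
    (hΘ : Mat X Y Θ) : fS (high m) (glueSet X Y Θ) = Y := by
  ext w
  rw [mem_fS]
  constructor
  · rintro ⟨h0, v, hv, rfl⟩
    rcases glue_cases h hΘ hv with h1 | h1 | h1
    · exact (Finset.mem_product.1 (hΘ.1 h1)).2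
    · exact absurd h1.2 h0
    · exact h1.2
  · intro hw
    refine ⟨(h.gY.1 w hw).1, ?_⟩
    by_cases hm : ∃ p ∈ Θ, p.2 = w
    · obtain ⟨p, hp, rfl⟩ := hm
      exact ⟨_, (h.pair hΘ hp).1, (h.pair hΘ hp).2.2⟩
    · push Not at hm
      exact ⟨w, mem_glue.2 (Or.inr (Or.inr ⟨hw, hm⟩)), (low_of_gt (h.lY w hw)).2⟩

theorem th_glue {m : ℕ} {X Y : Finset W} (h : Cfg m X Y) {Θ : Finset (W × W)}
    (hΘ : Mat X Y Θ) : thS m (glueSet X Y Θ) = Θ := by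
  ext p
  simp only [thS, Finset.mem_filter, Finset.mem_image]
  constructor
  · rintro ⟨⟨w, hw, rfl⟩, h1, h2⟩
    rcases glue_cases h hΘ hw with h3 | h3 | h3
    · exact h3
    · exact absurd h3.2 h2
    · exact absurd h3.1 h1
  · intro hp
    have hp' := Finset.mem_product.1 (hΘ.1 hp)
    obtain ⟨h1, h2, h3⟩ := h.pair hΘ hp
    exact ⟨⟨_, h1, by rw [h2, h3]⟩, (h.gX.1 _ hp'.1).1, (h.gY.1 _ hp'.2).1⟩

/-- heads of nonempty images are distinct -/
def HI (f : W → W) (G : Finset W) : Prop :=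
  ∀ u ∈ G, ∀ v ∈ G, f u ≠ [] → f v ≠ [] → hd (f u) = hd (f v) → u = v

theorem HI.inj {f : W → W} {G : Finset W} (h : HI f G) {u v : W} (hu : u ∈ G) (hv : v ∈ G)
    (h0 : f u ≠ []) (e : f u = f v) : u = v :=
  h u hu v hv h0 (e ▸ h0) (by rw [e])

theorem unglue {m : ℕ} {G : Finset W} (hne : [] ∉ G) (hs : ∀ w ∈ G, w = low m w ++ high m w)
    (hl : HI (low m) G) (hh : HI (high m) G) :
    Mat (fS (low m) G) (fS (high m) G) (thS m G) ∧
    glueSet (fS (low m) G) (fS (high m) G) (thS m G) = G := by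
  have hth : ∀ p, p ∈ thS m G ↔ p.1 ≠ [] ∧ p.2 ≠ [] ∧ ∃ w ∈ G, low m w = p.1 ∧ high m w = p.2 := by
    rintro ⟨p, q⟩
    simp [thS]
    tauto
  refine ⟨⟨?_, ?_⟩, ?_⟩
  · intro p hp
    obtain ⟨h1, h2, w, hw, e1, e2⟩ := (hth p).1 hp
    exact Finset.mem_product.2 ⟨mem_fS.2 ⟨h1, w, hw, e1⟩, mem_fS.2 ⟨h2, w, hw, e2⟩⟩
  · intro p hp q hq e
    obtain ⟨h1, h2, w, hw, e1, e2⟩ := (hth p).1 hp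
    obtain ⟨h1', h2', w', hw', e1', e2'⟩ := (hth q).1 hq
    have : w = w' := by
      rcases e with e | e
      · exact hl.inj hw hw' (by rwa [e1]) (by rw [e1, e1', e])
      · exact hh.inj hw hw' (by rwa [e2]) (by rw [e2, e2', e])
    subst this
    exact Prod.ext (e1.symm.trans e1') (e2.symm.trans e2')
  · ext w
    rw [mem_glue]
    constructor
    · rintro (⟨p, hp, rfl⟩ | ⟨hw, h1⟩ | ⟨hw, h1⟩)
      · obtain ⟨h1, h2, w, hw, e1, e2⟩ := (hth p).1 hp
        rw [← e1, ← e2, ← hs w hw]; exact hw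
      · obtain ⟨h0, v, hv, rfl⟩ := mem_fS.1 hw
        by_cases h2 : high m v = []
        · have := hs v hv
          rw [h2, List.append_nil] at this
          rw [← this]; exact hv
        · exact absurd rfl (h1 (low m v, high m v) ((hth _).2 ⟨h0, h2, v, hv, rfl, rfl⟩))
      · obtain ⟨h0, v, hv, rfl⟩ := mem_fS.1 hw
        by_cases h2 : low m v = []
        · have := hs v hv
          rw [h2, List.nil_append] at this
          rw [← this]; exact hv
        · exact absurd rfl (h1 (low m v, high m v) ((hth _).2 ⟨h2, h0, v, hv, rfl, rfl⟩))
    · intro hw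
      have hsw := hs w hw
      by_cases h1 : low m w = []
      · rw [h1, List.nil_append] at hsw
        right; right
        have h0 : high m w ≠ [] := by rw [← hsw]; rintro rfl; exact hne hw
        rw [hsw] at h0
        refine ⟨mem_fS.2 ⟨fun e => hne (e ▸ hw), w, hw, hsw.symm⟩, ?_⟩
        intro p hp e
        obtain ⟨h2, h3, v, hv, e1, e2⟩ := (hth p).1 hp
        have : v = w := hh.inj hv hw (by rwa [e2]) (by rw [e2, ← hsw, e])
        subst this
        exact h2 (e1.symm.trans h1)
      · by_cases h2 : high m w = []
        · rw [h2, List.append_nil] at hsw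
          right; left
          refine ⟨mem_fS.2 ⟨fun e => hne (e ▸ hw), w, hw, hsw.symm⟩, ?_⟩
          intro p hp e
          obtain ⟨h3, h4, v, hv, e1, e2⟩ := (hth p).1 hp
          have : v = w := hl.inj hv hw (by rwa [e1]) (by rw [e1, ← hsw, e])
          subst this
          exact h4 (e2.symm.trans h2)
        · left
          exact ⟨(low m w, high m w), (hth _).2 ⟨h1, h2, w, hw, rfl, rfl⟩, hsw.symm⟩

theorem shiftW_append (m : ℕ) (u v : W) : shiftW m (u ++ v) = shiftW m u ++ shiftW m v := by
  simp [shiftW]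

theorem HI.step {f : W → W} (hf : ∀ u v, f (u ++ v) = f u ++ f v) {G : Finset W} (h : HI f G)
    {u v : W} (hu : u ∈ G) (hv : v ∈ G) :
    HI f (insert (u ++ v) ((G.erase u).erase v)) := by
  have key : ∀ w ∈ (G.erase u).erase v, f w ≠ [] → f (u ++ v) ≠ [] → hd (f w) = hd (f (u ++ v)) →
      False := by
    intro w hw h1 h2 e
    simp only [Finset.mem_erase] at hw
    rw [hf] at h2 e
    by_cases hu0 : f u = []
    · rw [hu0, List.nil_append] at h2 e
      exact hw.1 (h w hw.2.2 v hv h1 h2 e)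
    · rw [hd_append hu0] at e
      exact hw.2.1 (h w hw.2.2 u hu h1 hu0 e)
  intro w hw w' hw' h1 h2 e
  rcases Finset.mem_insert.1 hw with hw1 | hw1 <;> rcases Finset.mem_insert.1 hw' with hw2 | hw2
  · rw [hw1, hw2]
  · subst hw1; exact (key w' hw2 h2 h1 e.symm).elim
  · subst hw2; exact (key w hw1 h1 h2 e).elim
  · simp only [Finset.mem_erase] at hw1 hw2
    exact h w hw1.2.2 w' hw2.2.2 h1 h2 e

theorem fS_step {f : W → W} (hf : ∀ u v, f (u ++ v) = f u ++ f v) (hsub : ∀ u, ∀ x ∈ f u, x ∈ u)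
    {G : Finset W} (h : HI f G) {u v : W} (hu : u ∈ G) (hv : v ∈ G) (huv : u ≠ v)
    (hle : ∀ x ∈ u, ∀ y ∈ v, x ≤ y) :
    Relation.ReflTransGen Mrg (fS f G) (fS f (insert (u ++ v) ((G.erase u).erase v))) := by
  by_cases hu0 : f u = []
  · have : fS f (insert (u ++ v) ((G.erase u).erase v)) = fS f G := by
      ext w
      simp only [mem_fS, Finset.mem_insert, Finset.mem_erase, exists_eq_or_imp, hf, hu0,
        List.nil_append]
      refine and_congr_right fun h0 => ?_
      constructor
      · rintro (rfl | ⟨z, hz, rfl⟩)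
        · exact ⟨v, hv, rfl⟩
        · exact ⟨z, hz.2.2, rfl⟩
      · rintro ⟨z, hz, rfl⟩
        by_cases hzv : z = v
        · left; rw [hzv]
        · exact Or.inr ⟨z, ⟨hzv, fun e => h0 (by rw [e, hu0]), hz⟩, rfl⟩
    rw [this]
  · by_cases hv0 : f v = []
    · have : fS f (insert (u ++ v) ((G.erase u).erase v)) = fS f G := by
        ext w
        simp only [mem_fS, Finset.mem_insert, Finset.mem_erase, exists_eq_or_imp, hf, hv0,
          List.append_nil]
        refine and_congr_right fun h0 => ?_
        constructor
        · rintro (rfl | ⟨z, hz, rfl⟩)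
          · exact ⟨u, hu, rfl⟩
          · exact ⟨z, hz.2.2, rfl⟩
        · rintro ⟨z, hz, rfl⟩
          by_cases hzv : z = u
          · left; rw [hzv]
          · exact Or.inr ⟨z, ⟨fun e => h0 (by rw [e, hv0]), hzv, hz⟩, rfl⟩
      rw [this]
    · apply Relation.ReflTransGen.single
      refine ⟨f u, mem_fS.2 ⟨hu0, u, hu, rfl⟩, f v, mem_fS.2 ⟨hv0, v, hv, rfl⟩,
        fun e => huv (h.inj hu hv hu0 e), fun x hx y hy => hle x (hsub u x hx) y (hsub v y hy), ?_⟩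
      ext w
      simp only [mem_fS, Finset.mem_insert, Finset.mem_erase, exists_eq_or_imp, hf]
      constructor
      · rintro ⟨h0, h1 | ⟨z, hz, rfl⟩⟩
        · exact Or.inl h1.symm
        · exact Or.inr ⟨fun e => hz.1 (h.inj hz.2.2 hv h0 e),
            fun e => hz.2.1 (h.inj hz.2.2 hu h0 e), h0, z, hz.2.2, rfl⟩
      · rintro (rfl | ⟨h1, h2, h0, z, hz, rfl⟩)
        · exact ⟨by simp [hu0], Or.inl rfl⟩
        · exact ⟨h0, Or.inr ⟨z, ⟨fun e => h1 (by rw [e]), fun e => h2 (by rw [e]), hz⟩, rfl⟩⟩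

theorem shift_injective (m : ℕ) : Function.Injective (shiftW m) := fun _ _ h => shiftW_inj h

theorem image_shift_merge (m : ℕ) (G : Finset W) (u v : W) :
    (insert (u ++ v) ((G.erase u).erase v)).image (shiftW m) =
    insert (shiftW m u ++ shiftW m v)
      (((G.image (shiftW m)).erase (shiftW m u)).erase (shiftW m v)) := by
  rw [Finset.image_insert, Finset.image_erase (shift_injective m),
    Finset.image_erase (shift_injective m), shiftW_append]

theorem shift_le {m : ℕ} {u v : W} :
    (∀ x ∈ shiftW m u, ∀ y ∈ shiftW m v, x ≤ y) ↔ ∀ x ∈ u, ∀ y ∈ v, x ≤ y := by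
  simp [shiftW]

theorem Mrg.shift {m : ℕ} {G G' : Finset W} (h : Mrg G G') :
    Mrg (G.image (shiftW m)) (G'.image (shiftW m)) := by
  obtain ⟨u, hu, v, hv, huv, hle, rfl⟩ := h
  exact ⟨_, Finset.mem_image_of_mem _ hu, _, Finset.mem_image_of_mem _ hv,
    fun e => huv (shiftW_inj e), shift_le.2 hle, image_shift_merge m G u v⟩

theorem Mrg.unshift {m : ℕ} {G H : Finset W} (h : Mrg (G.image (shiftW m)) H) :
    ∃ G', Mrg G G' ∧ H = G'.image (shiftW m) := by
  obtain ⟨u, hu, v, hv, huv, hle, rfl⟩ := h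
  obtain ⟨u, hu1, rfl⟩ := Finset.mem_image.1 hu
  obtain ⟨v, hv1, rfl⟩ := Finset.mem_image.1 hv
  exact ⟨_, ⟨u, hu1, v, hv1, fun e => huv (by rw [e]), shift_le.1 hle, rfl⟩,
    (image_shift_merge m G u v).symm⟩

theorem rtg_SFS {m : ℕ} {b : W} {H : Finset W} (h : Relation.ReflTransGen Mrg (SFS m b) H) :
    ∃ b', leStar b b' ∧ H = SFS m b' := by
  induction h with
  | refl => exact ⟨b, .refl, rfl⟩
  | tail _ h ih =>
    obtain ⟨b', hb', rfl⟩ := ih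
    obtain ⟨G', hG', rfl⟩ := h.unshift
    have hg := hG'.good (good_FS b')
    refine ⟨wordOfSet G', hb'.tail ?_, ?_⟩
    · rw [covStar_iff, FS_wordOfSet hg]; exact hG'
    · rw [SFS, FS_wordOfSet hg]

/-- invariant -/
structure GlueInv (m : ℕ) (a b : W) (G : Finset W) : Prop where
  good : Good G
  split : ∀ w ∈ G, w = low m w ++ high m w
  hl : HI (low m) G
  hh : HI (high m) G
  rl : Relation.ReflTransGen Mrg (FS a) (fS (low m) G)
  rh : Relation.ReflTransGen Mrg (SFS m b) (fS (high m) G)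

theorem GlueInv.step {m : ℕ} {a b : W} {G G' : Finset W} (h : GlueInv m a b G) (hm : Mrg G G') :
    GlueInv m a b G' := by
  have hg := hm.good h.good
  obtain ⟨u, hu, v, hv, huv, hle, rfl⟩ := hm
  refine ⟨hg, ?_, h.hl.step (low_append m) hu hv, h.hh.step (high_append m) hu hv,
    h.rl.trans (fS_step (low_append m) ?_ h.hl hu hv huv hle),
    h.rh.trans (fS_step (high_append m) ?_ h.hh hu hv huv hle)⟩
  · intro w hw
    rcases Finset.mem_insert.1 hw with rfl | hw
    · rw [low_append, high_append]
      have e1 := h.split u hu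
      have e2 := h.split v hv
      have : high m u = [] ∨ low m v = [] := by
        by_contra hcon
        push Not at hcon
        have h1 := hd_mem hcon.1
        have h2 := hd_mem hcon.2
        simp only [high, low, List.mem_filter, decide_eq_true_eq] at h1 h2
        have := hle _ h1.1 _ h2.1
        unfold high low at *
        omega
      conv_lhs => rw [e1, e2]
      rcases this with h1 | h1 <;> simp [h1]
    · simp only [Finset.mem_erase] at hw
      exact h.split w hw.2.2
  · intro u x hx; exact List.mem_of_mem_filter hx
  · intro u x hx; exact List.mem_of_mem_filter hx

theorem cfg_of {a b : W} (ha : IsPF a) (hb : IsPF b) : Cfg a.length (FS a) (SFS a.length b) :=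
  ⟨good_FS a, SFS_good _ b, fun _ hw => FS_le ha hw, fun _ hw => SFS_lt hb hw⟩

theorem mat_empty (X Y : Finset W) : Mat X Y ∅ := ⟨by simp, by simp⟩

theorem GlueInv.base {a b : W} (ha : IsPF a) (hb : IsPF b) :
    GlueInv a.length a b (FS (slashProd a b)) := by
  have hc := cfg_of ha hb
  have h1 := low_glue hc (mat_empty _ _)
  have h2 := high_glue hc (mat_empty _ _)
  rw [glue_empty] at h1 h2
  have hX : ∀ w ∈ FS a ∪ SFS a.length b, (w ∈ FS a ∧ low a.length w = w ∧ high a.length w = []) ∨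
      (w ∈ SFS a.length b ∧ low a.length w = [] ∧ high a.length w = w) := by
    intro w hw
    rcases Finset.mem_union.1 hw with hw | hw
    · exact Or.inl ⟨hw, low_of_le (hc.lX w hw)⟩
    · exact Or.inr ⟨hw, low_of_gt (hc.lY w hw)⟩
  rw [FS_slash ha hb]
  refine ⟨hc.good, ?_, ?_, ?_, by rw [h1], by rw [h2]⟩
  · intro w hw
    rcases hX w hw with ⟨-, e1, e2⟩ | ⟨-, e1, e2⟩ <;> simp [e1, e2]
  · intro u hu v hv hu0 hv0 e
    rcases hX u hu with ⟨hu', e1, e2⟩ | ⟨hu', e1, e2⟩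
    · rcases hX v hv with ⟨hv', e1', e2'⟩ | ⟨hv', e1', e2'⟩
      · rw [e1, e1'] at e
        exact hc.gX.2 u hu' v hv' e
      · exact absurd e1' hv0
    · exact absurd e1 hu0
  · intro u hu v hv hu0 hv0 e
    rcases hX u hu with ⟨hu', e1, e2⟩ | ⟨hu', e1, e2⟩
    · exact absurd e2 hu0
    · rcases hX v hv with ⟨hv', e1', e2'⟩ | ⟨hv', e1', e2'⟩
      · exact absurd e2' hv0
      · rw [e2, e2'] at e
        exact hc.gY.2 u hu' v hv' e

theorem inv_of_le {a b c : W} (ha : IsPF a) (hb : IsPF b) (h : leStar (slashProd a b) c) :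
    GlueInv a.length a b (FS c) := by
  rw [leStar_iff] at h
  generalize FS c = G at h
  induction h with
  | refl => exact GlueInv.base ha hb
  | tail _ h ih => exact ih.step h

theorem mem_Rset {a b : W} {Θ : Finset (W × W)} :
    Θ ∈ Rset a b ↔ Mat (FS a) (SFS a.length b) Θ := by
  rw [Rset, Finset.mem_filter, Finset.mem_powerset, shiftF_toFinset]
  rfl

theorem mTheta_eq (a b : W) (Θ : Finset (W × W)) :
    mTheta a b Θ = wordOfSet (glueSet (FS a) (SFS a.length b) Θ) := by
  rw [mTheta, shiftF_toFinset]; rfl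

theorem FS_mTheta {a b : W} (ha : IsPF a) (hb : IsPF b) {Θ : Finset (W × W)} (h : Θ ∈ Rset a b) :
    FS (mTheta a b Θ) = glueSet (FS a) (SFS a.length b) Θ := by
  rw [mTheta_eq, FS_wordOfSet (glue_good (cfg_of ha hb) Θ (mem_Rset.1 h))]

theorem surj {a b c : W} (ha : IsPF a) (hb : IsPF b) (h : leStar (slashProd a b) c) :
    ∃ a' b', leStar a a' ∧ leStar b b' ∧ ∃ Θ ∈ Rset a' b', mTheta a' b' Θ = c := by
  have hi := inv_of_le ha hb h
  have hu := unglue (m := a.length) (fun h0 => (hi.good.1 _ h0).1 rfl) hi.split hi.hl hi.hh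
  obtain ⟨hg, ha'⟩ := rtg_mrg hi.rl
  obtain ⟨b', hb', e⟩ := rtg_SFS hi.rh
  have hlen := (leStar_perm ha').length_eq
  refine ⟨_, b', ha', hb', thS a.length (FS c), ?_, ?_⟩
  · rw [mem_Rset, FS_wordOfSet hg, hlen, ← e]; exact hu.1
  · rw [mTheta_eq, FS_wordOfSet hg, hlen, ← e, hu.2, wordOfSet_FS]

theorem Mrg.union_right {G G' H : Finset W} (h : Mrg G G') (hd : Disjoint G H) :
    Mrg (G ∪ H) (G' ∪ H) := by
  obtain ⟨u, hu, v, hv, huv, hle, rfl⟩ := h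
  refine ⟨u, Finset.mem_union_left _ hu, v, Finset.mem_union_left _ hv, huv, hle, ?_⟩
  have h1 : u ∉ H := Finset.disjoint_left.1 hd hu
  have h2 : v ∉ H := Finset.disjoint_left.1 hd hv
  rw [Finset.insert_union, Finset.erase_union_distrib, Finset.erase_union_distrib,
    Finset.erase_eq_of_notMem h1, Finset.erase_eq_of_notMem h2]

theorem Cfg.disj {m : ℕ} {X Y : Finset W} (h : Cfg m X Y) : Disjoint X Y :=
  Finset.disjoint_left.2 fun _ hw hw' => h.hd_ne hw hw' rfl

theorem slash_mono_left {a a' b : W} (ha : IsPF a) (hb : IsPF b) (h : leStar a a') :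
    Relation.ReflTransGen Mrg (FS a ∪ SFS a.length b) (FS a' ∪ SFS a.length b) := by
  unfold leStar at h
  induction h with
  | refl => exact .refl
  | @tail c d h1 h2 ih =>
    refine ih.tail (((covStar_iff _ _).1 h2).union_right ?_)
    have := (cfg_of (leStar_pf ha h1) hb).disj
    rwa [(leStar_perm h1).length_eq] at this

theorem slash_mono_right {a b b' : W} (ha : IsPF a) (hb : IsPF b) (h : leStar b b') :
    Relation.ReflTransGen Mrg (FS a ∪ SFS a.length b) (FS a ∪ SFS a.length b') := by
  unfold leStar at h
  induction h with
  | refl => exact .refl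
  | @tail c d h1 h2 ih =>
    refine ih.tail ?_
    rw [Finset.union_comm, Finset.union_comm (FS a)]
    exact (((covStar_iff _ _).1 h2).shift).union_right (cfg_of ha (leStar_pf hb h1)).disj.symm

theorem le_mTheta {a b a' b' : W} (ha : IsPF a) (hb : IsPF b) (h1 : leStar a a') (h2 : leStar b b')
    {Θ : Finset (W × W)} (hΘ : Θ ∈ Rset a' b') : leStar (slashProd a b) (mTheta a' b' Θ) := by
  have ha' := leStar_pf ha h1
  have hb' := leStar_pf hb h2
  have hlen := (leStar_perm h1).length_eq
  rw [leStar_iff, FS_mTheta ha' hb' hΘ, FS_slash ha hb]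
  refine (slash_mono_left ha hb h1).trans ?_
  rw [← hlen]
  exact (slash_mono_right ha' hb h2).trans (glue_rtg (cfg_of ha' hb') Θ (mem_Rset.1 hΘ))

theorem SFS_inj {m : ℕ} {b b' : W} (h : SFS m b = SFS m b') : b = b' :=
  FS_inj (Finset.image_injective (shift_injective m) h)

theorem mTheta_inj {a b a' b' : W} (ha : IsPF a) (hb : IsPF b) (ha' : IsPF a') (hb' : IsPF b')
    (hlen : a.length = a'.length) {Θ Θ' : Finset (W × W)} (hΘ : Θ ∈ Rset a b)
    (hΘ' : Θ' ∈ Rset a' b') (e : mTheta a b Θ = mTheta a' b' Θ') : a = a' ∧ b = b' ∧ Θ = Θ' := by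
  have h := congrArg FS e
  rw [FS_mTheta ha hb hΘ, FS_mTheta ha' hb' hΘ'] at h
  have c := cfg_of ha hb
  have c' := cfg_of ha' hb'
  have m := mem_Rset.1 hΘ
  have m' := mem_Rset.1 hΘ'
  rw [← hlen] at c' m' h
  have h1 := congrArg (fS (low a.length)) h
  have h2 := congrArg (fS (high a.length)) h
  have h3 := congrArg (thS a.length) h
  rw [low_glue c m, low_glue c' m'] at h1
  rw [high_glue c m, high_glue c' m'] at h2
  rw [th_glue c m, th_glue c' m'] at h3
  exact ⟨FS_inj h1, SFS_inj h2, h3⟩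

theorem starF_sum (K : Type) [Field K] (S T : Finset W) :
    starF K (∑ a ∈ S, Mb K a) (∑ b ∈ T, Mb K b) = ∑ a ∈ S, ∑ b ∈ T, mulSingle K a b := by
  unfold starF
  rw [← Finsupp.sum_finsetSum_index]
  · refine Finset.sum_congr rfl fun a _ => ?_
    rw [Mb, Finsupp.sum_single_index (by simp)]
    rw [← Finsupp.sum_finsetSum_index]
    · refine Finset.sum_congr rfl fun b _ => ?_
      rw [Mb, Finsupp.sum_single_index (by simp)]
      simp
    · simp
    · intro a x y; rw [mul_add, add_smul]
  · simp
  · intro a x y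
    rw [← Finsupp.sum_add]
    refine Finsupp.sum_congr fun b _ => ?_
    rw [add_mul, add_smul]

theorem Q_mul (K : Type) [Field K] {a b : W} (ha : IsPF a) (hb : IsPF b) :
    starF K (Qb K a) (Qb K b) = Qb K (slashProd a b) := by
  unfold Qb
  rw [starF_sum]
  simp only [mulSingle]
  simp_rw [Finset.sum_sigma']
  refine Finset.sum_bij (fun x _ => mTheta x.1 x.2.1 x.2.2) ?_ ?_ ?_ ?_
  · rintro ⟨a', b', Θ⟩ hx
    simp only [Finset.mem_sigma, mem_Qset ha, mem_Qset hb] at hx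
    rw [mem_Qset (pf_slash ha hb)]
    exact le_mTheta ha hb hx.1 hx.2.1 hx.2.2
  · rintro ⟨a', b', Θ⟩ hx ⟨a'', b'', Θ'⟩ hy e
    simp only [Finset.mem_sigma, mem_Qset ha, mem_Qset hb] at hx hy
    obtain ⟨rfl, rfl, rfl⟩ := mTheta_inj (leStar_pf ha hx.1) (leStar_pf hb hx.2.1)
      (leStar_pf ha hy.1) (leStar_pf hb hy.2.1)
      ((leStar_perm hx.1).length_eq.trans (leStar_perm hy.1).length_eq.symm) hx.2.2 hy.2.2 e
    rfl
  · intro c hc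
    rw [mem_Qset (pf_slash ha hb)] at hc
    obtain ⟨a', b', h1, h2, Θ, hΘ, e⟩ := surj ha hb hc
    refine ⟨⟨a', b', Θ⟩, ?_, e⟩
    simp only [Finset.mem_sigma, mem_Qset ha, mem_Qset hb]
    exact ⟨h1, h2, hΘ⟩
  · intro x _; rfl

theorem Qb_apply (K : Type) [Field K] {a : W} (ha : IsPF a) (b : W) :
    Qb K a b = if leStar a b then 1 else 0 := by
  unfold Qb
  rw [Finsupp.finsetSum_apply]
  simp only [Mb, Finsupp.single_apply]
  rw [Finset.sum_ite_eq']
  simp only [mem_Qset ha]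

theorem Qb_nil (K : Type) [Field K] : Qb K [] = Mb K [] := by
  ext b
  rw [Qb_apply K nil_pf, Mb, Finsupp.single_apply]
  congr 1
  refine propext ⟨fun h => ?_, fun h => h ▸ .refl⟩
  exact (List.Perm.eq_nil (leStar_perm h)).symm

theorem qList_eq (K : Type) [Field K] {L : List W} (h : ∀ x ∈ L, AtomicPF x) :
    qList K L = Qb K (slashL L) := by
  induction L with
  | nil => exact (Qb_nil K).symm
  | cons x L ih =>
    have hL : ∀ y ∈ L, AtomicPF y := fun y hy => h y (by simp [hy])
    change starF K (Qb K x) (qList K L) = Qb K (slashProd x (slashL L))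
    rw [ih hL, Q_mul K (h x (by simp)).1 (slashL_pf hL)]

theorem Q_linInd (K : Type) [Field K] :
    LinearIndependent K (fun a : {a : W // IsPF a} => Qb K a.1) := by
  rw [linearIndependent_iff']
  intro s g hg
  by_contra hcon
  push Not at hcon
  obtain ⟨i, hi, hgi⟩ := hcon
  obtain ⟨a, ha, hmax⟩ := Finset.exists_max_image (s.filter fun a => g a ≠ 0)
    (fun a => (FS a.1).card) ⟨i, by simp [hi, hgi]⟩
  rw [Finset.mem_filter] at ha
  have h := congrArg (fun z : FW K => z a.1) hg
  simp only [Finsupp.finsetSum_apply, Finsupp.smul_apply, smul_eq_mul, Finsupp.zero_apply] at h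
  rw [Finset.sum_eq_single a] at h
  · rw [Qb_apply K a.2, if_pos (show leStar a.1 a.1 from Relation.ReflTransGen.refl), mul_one] at h
    exact ha.2 h
  · intro b hb hba
    by_cases hgb : g b = 0
    · rw [hgb, zero_mul]
    rw [Qb_apply K b.2, if_neg, mul_zero]
    intro hle
    rcases leStar_card hle with e | e
    · exact hba (Subtype.ext e)
    · have := hmax b (by simp [hb, hgb])
      omega
  · intro h'; exact absurd ha.1 h'

theorem M_mem_span (K : Type) [Field K] (a : W) (ha : IsPF a) :
    Mb K a ∈ Submodule.span K {z : FW K | ∃ a : W, IsPF a ∧ z = Qb K a} := by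
  induction hn : (FS a).card using Nat.strong_induction_on generalizing a with
  | _ n ih =>
    subst hn
    have hmem : a ∈ (pfFinset a.length).filter (fun b => leStar a b) :=
      (mem_Qset ha).2 Relation.ReflTransGen.refl
    have e : Mb K a = Qb K a -
        ∑ b ∈ ((pfFinset a.length).filter (fun b => leStar a b)).erase a, Mb K b := by
      rw [Qb, ← Finset.add_sum_erase _ _ hmem, add_sub_cancel_right]
    rw [e]
    refine Submodule.sub_mem _ (Submodule.subset_span ⟨a, ha, rfl⟩) (Submodule.sum_mem _ ?_)
    intro b hb
    rw [Finset.mem_erase, mem_Qset ha] at hb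
    refine ih _ ?_ b (leStar_pf ha hb.2) rfl
    rcases leStar_card hb.2 with h | h
    · exact absurd h.symm hb.1
    · exact h

/-- The algebra `(KP, ⋆)` is freely generated by
`{Q_a : a atomic}`: the canonical map from the free associative algebra on the
atomic parking functions is multiplicative, and it carries the basis of the
free algebra (words in the generators) to a linearly independent family whose
span is exactly `KP`; i.e. it is an algebra isomorphism onto `(KP, ⋆)`. -/
theorem stmt14 (K : Type) [Field K] [CharZero K] :
    (∀ L₁ L₂ : List W, (∀ x ∈ L₁ ++ L₂, AtomicPF x) →
      qList K (L₁ ++ L₂) = starF K (qList K L₁) (qList K L₂)) ∧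
    LinearIndependent K
      (fun L : List {a : W // AtomicPF a} => qList K (L.map Subtype.val)) ∧
    Submodule.span K
        (Set.range (fun L : List {a : W // AtomicPF a} =>
          qList K (L.map Subtype.val))) =
      Submodule.span K {z : FW K | ∃ a : W, IsPF a ∧ z = Mb K a} := by
  have hval : ∀ L : List {a : W // AtomicPF a}, ∀ x ∈ L.map Subtype.val, AtomicPF x := by
    intro L x hx
    obtain ⟨y, _, rfl⟩ := List.mem_map.1 hx
    exact y.2
  have hfun : (fun L : List {a : W // AtomicPF a} => qList K (L.map Subtype.val)) =
      fun L => Qb K (slashL (L.map Subtype.val)) := funext fun L => qList_eq K (hval L)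
  refine ⟨?_, ?_, ?_⟩
  · intro L₁ L₂ h
    have h1 : ∀ x ∈ L₁, AtomicPF x := fun x hx => h x (by simp [hx])
    have h2 : ∀ x ∈ L₂, AtomicPF x := fun x hx => h x (by simp [hx])
    rw [qList_eq K h, qList_eq K h1, qList_eq K h2, Q_mul K (slashL_pf h1) (slashL_pf h2),
      slashL_append]
  · rw [hfun]
    refine (Q_linInd K).comp
      (fun L : List {a : W // AtomicPF a} => ⟨slashL (L.map Subtype.val), slashL_pf (hval L)⟩) ?_
    intro L L' e
    have := slashL_inj (hval L) (hval L') (congrArg Subtype.val e)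
    exact List.map_injective_iff.2 Subtype.val_injective this
  · rw [hfun]
    apply le_antisymm
    · rw [Submodule.span_le]
      rintro _ ⟨L, rfl⟩
      refine Submodule.sum_mem _ fun b hb => Submodule.subset_span ⟨b, ?_, rfl⟩
      exact leStar_pf (slashL_pf (hval L)) ((mem_Qset (slashL_pf (hval L))).1 hb)
    · rw [Submodule.span_le]
      rintro _ ⟨a, ha, rfl⟩
      refine Submodule.span_mono ?_ (M_mem_span K a ha)
      rintro _ ⟨b, hb, rfl⟩
      obtain ⟨L, hL, rfl⟩ := exists_atomic b hb
      refine ⟨L.attach.map fun x => ⟨x.1, hL x.1 x.2⟩, ?_⟩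
      simp [List.map_map, Function.comp_def]
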